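/- arXiv:2009.07512 — 2 statements merged into one kernel-verified Lean document; each statement's English description precedes it below -/
import Mathlib

section
/- Consider the problem: minimize J[x] = ∫₀¹ f(x(t), t) dt + q(x(1)) over arcs x : [0,1] → ℝⁿ that are twice differentiable with integrable second derivative and satisfy W¹_k(x(t), x''(t)) ≤ 0 for a.e. t ∈ [0,1] (k = 1, …, m), x(0) = v₀, x'(0) = v₁, where each f(·, t) : ℝⁿ → ℝ is convex and differentiable with t ↦ f(x(t), t) integrable along feasible arcs, each W¹_k : ℝⁿ × ℝⁿ → ℝ is convex, and q : ℝⁿ → ℝ is convex. Let x̃ be a feasible arc and suppose there exist a twice differentiable x* : [0,1] → ℝⁿ with integrable second derivative and measurable functions α_k : [0,1] → [0,∞) such that for almost every t ∈ [0,1]: (a) there exist subgradients s_k(t) ∈ ∂W¹_k(x̃(t), x̃''(t)) with (x*''(t) − ∇f(x̃(t), t), −x*(t)) = ∑_{k=1}^m α_k(t) s_k(t); (b) −x*'(1) is a subgradient of q at x̃(1) and x*(1) = 0; and (c) α_k(t) · W¹_k(x̃(t), x̃''(t)) = 0 for every k. Then x̃ is optimal: J[x] ≥ J[x̃] for every feasible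 arc x. -/
open scoped RealInnerProductSpace
open Set MeasureTheory

noncomputable section

abbrev E (n : ℕ) := EuclideanSpace ℝ (Fin n)

/-- The product inner product on `ℝⁿ × ℝⁿ × ℝⁿ`. -/
def inner3 {n : ℕ} (a b : E n × E n × E n) : ℝ :=
  ⟪a.1, b.1⟫ + ⟪a.2.1, b.2.1⟫ + ⟪a.2.2, b.2.2⟫

/-- `s` is a subgradient of `g : ℝⁿ × ℝⁿ × ℝⁿ → ℝ` at `x`. -/
def IsSubgrad3 {n : ℕ} (g : E n × E n × E n → ℝ) (x s : E n × E n × E n) : Prop :=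
  ∀ y, g y - g x ≥ inner3 s (y - x)

/-- The product inner product on `ℝⁿ × ℝⁿ`. -/
def inner2 {n : ℕ} (a b : E n × E n) : ℝ :=
  ⟪a.1, b.1⟫ + ⟪a.2, b.2⟫

/-- `s` is a subgradient of `g : ℝⁿ × ℝⁿ → ℝ` at `x`. -/
def IsSubgrad2 {n : ℕ} (g : E n × E n → ℝ) (x s : E n × E n) : Prop :=
  ∀ y, g y - g x ≥ inner2 s (y - x)

/-- `s` is a subgradient of `g : ℝⁿ → ℝ` at `x`. -/
def IsSubgrad1 {n : ℕ} (g : E n → ℝ) (x s : E n) : Prop :=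
  ∀ y, g y - g x ≥ ⟪s, y - x⟫

/-- Feasible arcs: `x` twice differentiable on `[0,1]` with integrable second
derivative, satisfying `W¹_k(x(t), x''(t)) ≤ 0` a.e. and the initial conditions. -/
def FeasiblePC1 (n m : ℕ) (W1 : Fin m → E n × E n → ℝ) (v0 v1 : E n)
    (x x' x'' : ℝ → E n) : Prop :=
  (∀ t ∈ Icc (0 : ℝ) 1, HasDerivWithinAt x (x' t) (Icc 0 1) t) ∧
  (∀ t ∈ Icc (0 : ℝ) 1, HasDerivWithinAt x' (x'' t) (Icc 0 1) t) ∧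
  IntegrableOn x'' (Icc (0 : ℝ) 1) ∧
  (∀ᵐ t : ℝ ∂volume, t ∈ Icc (0 : ℝ) 1 → ∀ k, W1 k (x t, x'' t) ≤ 0) ∧
  x 0 = v0 ∧ x' 0 = v1

/-- The Bolza cost functional. -/
def J (n : ℕ) (f : ℝ → E n → ℝ) (q : E n → ℝ) (x : ℝ → E n) : ℝ :=
  (∫ t in (0 : ℝ)..1, f t (x t)) + q (x 1)

/-- First-order condition for convexity: the tangent hyperplane lies below the graph. -/
theorem ConvexOn.inner_gradient_le_sub {F : Type*} [NormedAddCommGroup F] [InnerProductSpace ℝ F]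
    [CompleteSpace F] {g : F → ℝ} (hg : ConvexOn ℝ univ g) {x : F}
    (hd : DifferentiableAt ℝ g x) (y : F) :
    ⟪gradient g x, y - x⟫ ≤ g y - g x := by
  have hconv : ConvexOn ℝ univ (g ∘ AffineMap.lineMap (k := ℝ) x y) :=
    hg.comp_affineMap (AffineMap.lineMap x y)
  have hd' : HasFDerivAt g (InnerProductSpace.toDual ℝ F (gradient g x))
      (AffineMap.lineMap (k := ℝ) x y 0) := by
    simpa using hd.hasGradientAt.hasFDerivAt
  have hderiv : HasDerivAt (g ∘ AffineMap.lineMap (k := ℝ) x y) ⟪gradient g x, y - x⟫ (0 : ℝ) := by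
    simpa using hd'.comp_hasDerivAt (0 : ℝ) AffineMap.hasDerivAt_lineMap
  simpa [slope_def_field] using
    hconv.le_slope_of_hasDerivAt (mem_univ (0 : ℝ)) (mem_univ (1 : ℝ)) one_pos hderiv

theorem MeasureTheory.IntegrableOn.inner_continuousOn {X F : Type*} [TopologicalSpace X]
    [T2Space X] [MeasurableSpace X] [OpensMeasurableSpace X] 
    [TopologicalSpace.PseudoMetrizableSpace X]
    {μ : Measure X} [NormedAddCommGroup F] [InnerProductSpace ℝ F]
    {g h : X → F} {K : Set X} (hg : IntegrableOn g K μ) (hh : ContinuousOn h K)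
    (hK : IsCompact K) : IntegrableOn (fun t => ⟪g t, h t⟫) K μ := by
  obtain ⟨C, hC⟩ := hK.exists_bound_of_continuousOn hh
  refine Integrable.mono' (hg.norm.mul_const C)
    (hg.aestronglyMeasurable.inner (hh.aestronglyMeasurable_of_isCompact hK hK.measurableSet)) ?_
  filter_upwards [ae_restrict_mem hK.measurableSet] with t ht
  exact (norm_inner_le_norm _ _).trans (mul_le_mul_of_nonneg_left (hC t ht) (norm_nonneg _))

theorem inner2_sum_smul {n : ℕ} {ι : Type*} (s : Finset ι) (c : ι → ℝ) (v : ι → E n × E n)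
    (w : E n × E n) : inner2 (∑ k ∈ s, c k • v k) w = ∑ k ∈ s, c k * inner2 (v k) w := by
  simp only [inner2, Prod.fst_sum, Prod.snd_sum, sum_inner, Prod.smul_fst, Prod.smul_snd,
    real_inner_smul_left, mul_add, Finset.sum_add_distrib]

/-- A nonnegative combination of subgradients with complementary slackness is an outward normal
to the feasible set `{y | ∀ k, W k y ≤ 0}`. -/
theorem inner2_sum_smul_nonpos {n : ℕ} {ι : Type*} [Fintype ι] {W : ι → E n × E n → ℝ}
    {p : E n × E n} {c : ι → ℝ} {s : ι → E n × E n} (hc : ∀ k, 0 ≤ c k)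
    (hs : ∀ k, IsSubgrad2 (W k) p (s k)) (hslack : ∀ k, c k * W k p = 0)
    {y : E n × E n} (hy : ∀ k, W k y ≤ 0) : inner2 (∑ k, c k • s k) (y - p) ≤ 0 := by
  rw [inner2_sum_smul]
  refine Finset.sum_nonpos fun k _ => ?_
  have h₁ := mul_le_mul_of_nonneg_left (hs k y) (hc k)
  have h₂ := mul_nonpos_of_nonneg_of_nonpos (hc k) (hy k)
  rw [mul_sub, hslack k] at h₁
  linarith

/-- Green's identity for the operator `d²/dt²`, with the integrand shown integrable. -/
theorem integral_inner_second_deriv_sub {F : Type*} [NormedAddCommGroup F]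
    [InnerProductSpace ℝ F] {a b : ℝ} (hab : a ≤ b) {p p' p'' h h' h'' : ℝ → F}
    (hp : ∀ t ∈ Icc a b, HasDerivWithinAt p (p' t) (Icc a b) t)
    (hp' : ∀ t ∈ Icc a b, HasDerivWithinAt p' (p'' t) (Icc a b) t)
    (hpi : IntegrableOn p'' (Icc a b))
    (hh : ∀ t ∈ Icc a b, HasDerivWithinAt h (h' t) (Icc a b) t)
    (hh' : ∀ t ∈ Icc a b, HasDerivWithinAt h' (h'' t) (Icc a b) t)
    (hhi : IntegrableOn h'' (Icc a b)) :
    IntervalIntegrable (fun t => ⟪p'' t, h t⟫ - ⟪p t, h'' t⟫) volume a b ∧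
    ∫ t in a..b, (⟪p'' t, h t⟫ - ⟪p t, h'' t⟫) =
      (⟪p' b, h b⟫ - ⟪p b, h' b⟫) - (⟪p' a, h a⟫ - ⟪p a, h' a⟫) := by
  have hint : IntervalIntegrable (fun t => ⟪p'' t, h t⟫ - ⟪p t, h'' t⟫) volume a b := by
    rw [intervalIntegrable_iff_integrableOn_Icc_of_le hab]
    refine (hpi.inner_continuousOn (fun t ht => (hh t ht).continuousWithinAt) isCompact_Icc).sub ?_
    simpa only [real_inner_comm] using
      hhi.inner_continuousOn (fun t ht => (hp t ht).continuousWithinAt) isCompact_Icc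
  have hderiv : ∀ t ∈ Icc a b, HasDerivWithinAt (fun t => ⟪p' t, h t⟫ - ⟪p t, h' t⟫)
      (⟪p'' t, h t⟫ - ⟪p t, h'' t⟫) (Icc a b) t := fun t ht => by
    exact (((hp' t ht).inner ℝ (hh t ht)).sub ((hp t ht).inner ℝ (hh' t ht))).congr_deriv
      (by ring)
  exact ⟨hint, intervalIntegral.integral_eq_sub_of_hasDerivAt_of_le hab
    (fun t ht => (hderiv t ht).continuousWithinAt)
    (fun t ht => (hderiv t (Ioo_subset_Icc_self ht)).hasDerivAt (Icc_mem_nhds ht.1 ht.2)) hint⟩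

theorem stmt11 (n m : ℕ) (v0 v1 : E n)
    (f : ℝ → E n → ℝ) (q : E n → ℝ)
    (W1 : Fin m → E n × E n → ℝ)
    (hfconv : ∀ t, ConvexOn ℝ univ (f t))
    (hfdiff : ∀ t, Differentiable ℝ (f t))
    (hfint : ∀ x x' x'' : ℝ → E n, FeasiblePC1 n m W1 v0 v1 x x' x'' →
      IntervalIntegrable (fun t => f t (x t)) volume 0 1)
    (hWconv : ∀ k, ConvexOn ℝ univ (W1 k))
    (hqconv : ConvexOn ℝ univ q)
    (xtil xtil' xtil'' : ℝ → E n)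
    (hfeas : FeasiblePC1 n m W1 v0 v1 xtil xtil' xtil'')
    (xs xs' xs'' : ℝ → E n)
    (hxs : ∀ t ∈ Icc (0 : ℝ) 1, HasDerivWithinAt xs (xs' t) (Icc 0 1) t)
    (hxs' : ∀ t ∈ Icc (0 : ℝ) 1, HasDerivWithinAt xs' (xs'' t) (Icc 0 1) t)
    (hxsint : IntegrableOn xs'' (Icc (0 : ℝ) 1))
    (α : Fin m → ℝ → ℝ)
    (hαmeas : ∀ k, Measurable (α k))
    (hαpos : ∀ k, ∀ t ∈ Icc (0 : ℝ) 1, 0 ≤ α k t)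
    -- (a) the adjoint inclusion and (c) complementary slackness a.e.
    (hadj : ∀ᵐ t : ℝ ∂volume, t ∈ Icc (0 : ℝ) 1 →
      (∃ sk : Fin m → E n × E n,
        (∀ k, IsSubgrad2 (W1 k) (xtil t, xtil'' t) (sk k)) ∧
        (xs'' t - gradient (f t) (xtil t), -xs t) = ∑ k, α k t • sk k) ∧
      (∀ k, α k t * W1 k (xtil t, xtil'' t) = 0))
    -- (b) transversality conditions
    (htrans : IsSubgrad1 q (xtil 1) (-xs' 1))
    (hend : xs 1 = 0) :
    ∀ x x' x'' : ℝ → E n, FeasiblePC1 n m W1 v0 v1 x x' x'' →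
      J n f q x ≥ J n f q xtil := by
  intro x x' x'' hx
  have hfx := hfint x x' x'' hx
  have hftil := hfint xtil xtil' xtil'' hfeas
  obtain ⟨hx₁, hx₂, hxi, hxW, hx0, hx0'⟩ := hx
  obtain ⟨ht₁, ht₂, hti, -, ht0, ht0'⟩ := hfeas
  obtain ⟨hint, hgreen⟩ := integral_inner_second_deriv_sub zero_le_one hxs hxs' hxsint
    (h := x - xtil) (h' := x' - xtil') (h'' := x'' - xtil'')
    (fun t ht => (hx₁ t ht).sub (ht₁ t ht)) (fun t ht => (hx₂ t ht).sub (ht₂ t ht)) (hxi.sub hti)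
  have hle : (fun t => ⟪xs'' t, (x - xtil) t⟫ - ⟪xs t, (x'' - xtil'') t⟫)
      ≤ᵐ[volume.restrict (Icc 0 1)] fun t => f t (x t) - f t (xtil t) := by
    filter_upwards [ae_restrict_of_ae hxW, ae_restrict_of_ae hadj,
      ae_restrict_mem measurableSet_Icc] with t hW hA ht
    obtain ⟨⟨s, hs, hsum⟩, hslack⟩ := hA ht
    have hnormal := inner2_sum_smul_nonpos (fun k => hαpos k t ht) hs hslack (hW ht)
    have hgrad := (hfconv t).inner_gradient_le_sub (hfdiff t (xtil t)) (x t)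
    simp only [← hsum, inner2, Prod.fst_sub, Prod.snd_sub, inner_sub_left, inner_neg_left]
      at hnormal
    simp only [Pi.sub_apply]
    linarith
  have hmono := intervalIntegral.integral_mono_ae_restrict zero_le_one hint (hfx.sub hftil) hle
  rw [hgreen, intervalIntegral.integral_sub hfx hftil] at hmono
  simp only [Pi.sub_apply, hend, hx0, hx0', ht0, ht0', sub_self, inner_zero_left,
    inner_zero_right, sub_zero] at hmono
  have hq := htrans (x 1)
  rw [inner_neg_left] at hq
  simp only [J]
  linarith
end
end

section
/- Consider the boundary value problem: minimize J[x] = ∫₀¹ f(x(t), t) dt + q(x(1)) over arcs x : [0,1] → ℝⁿ that are twice differentiable with integrable second derivative and satisfy W_k(x(t), x'(t), x''(t)) ≤ 0 for a.e. t ∈ [0,1] (k = 1, …, m), x(0) ∈ Q₀ and x(1) ∈ Q₁, where Q₀, Q₁ ⊆ ℝⁿ are convex sets, each f(·, t) : ℝⁿ → ℝ is convex and differentiable with t ↦ f(x(t), t) integrable along feasible arcs, each W_k : ℝⁿ × ℝⁿ × ℝⁿ → ℝ is convex, and q : ℝⁿ → ℝ is convex. Let x̃ be a feasible arc and suppose there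 exist x*, ψ* : [0,1] → ℝⁿ (x* twice differentiable with integrable second derivative, ψ* differentiable with integrable derivative) and measurable α_k : [0,1] → [0,∞) such that: for a.e. t ∈ [0,1] there exist subgradients s_k(t) ∈ ∂W_k(x̃(t), x̃'(t), x̃''(t)) with (x*''(t) + ψ*'(t) − ∇f(x̃(t), t), ψ*(t), −x*(t)) = ∑_{k=1}^m α_k(t) s_k(t) and α_k(t) · W_k(x̃(t), x̃'(t), x̃''(t)) = 0 for all k; ⟨−ψ*(0) − x*'(0), w − x̃(0)⟩ ≥ 0 for all w ∈ Q₀; ⟨ψ*(1), w − x̃(1)⟩ ≥ 0 for all w ∈ Q₁; −x*'(1) is a subgradient of q at x̃(1); and x*(0) = x*(1) = 0. Then x̃ is optimal: J[x] ≥ J[x̃] for every feasible arc x. -/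
open scoped RealInnerProductSpace
open Set MeasureTheory

noncomputable section

/-- Feasible arcs for the boundary value problem: twice differentiable on `[0,1]`
with integrable second derivative, satisfying the inequality constraints a.e.
and the boundary conditions `x(0) ∈ Q₀`, `x(1) ∈ Q₁`. -/
def FeasibleBV (n m : ℕ) (W : Fin m → E n × E n × E n → ℝ) (Q0 Q1 : Set (E n))
    (x x' x'' : ℝ → E n) : Prop :=
  (∀ t ∈ Icc (0 : ℝ) 1, HasDerivWithinAt x (x' t) (Icc 0 1) t) ∧
  (∀ t ∈ Icc (0 : ℝ) 1, HasDerivWithinAt x' (x'' t) (Icc 0 1) t) ∧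
  IntegrableOn x'' (Icc (0 : ℝ) 1) ∧
  (∀ᵐ t : ℝ ∂volume, t ∈ Icc (0 : ℝ) 1 → ∀ k, W k (x t, x' t, x'' t) ≤ 0) ∧
  x 0 ∈ Q0 ∧ x 1 ∈ Q1

/-- The gradient of a differentiable convex function is a subgradient. -/
theorem IsSubgrad1.gradient {n : ℕ} {g : E n → ℝ} (hconv : ConvexOn ℝ univ g)
    (hdiff : Differentiable ℝ g) (x : E n) : IsSubgrad1 g x (gradient g x) := by
  intro y
  have hline : HasDerivAt (fun s : ℝ => AffineMap.lineMap x y s) (y - x) 0 :=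
    AffineMap.hasDerivAt_lineMap
  have hg : HasFDerivAt g (fderiv ℝ g x) (AffineMap.lineMap x y (0 : ℝ)) := by
    simpa using (hdiff x).hasFDerivAt
  have hderiv : HasDerivAt (g ∘ AffineMap.lineMap x y) (fderiv ℝ g x (y - x)) (0 : ℝ) :=
    hg.comp_hasDerivAt 0 hline
  have hcomp : ConvexOn ℝ univ (g ∘ AffineMap.lineMap (k := ℝ) x y) :=
    hconv.comp_affineMap (AffineMap.lineMap x y)
  have hslope := hcomp.le_slope_of_hasDerivAt (mem_univ 0) (mem_univ 1) one_pos hderiv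
  simp only [slope_def_field, Function.comp_apply, AffineMap.lineMap_apply_zero,
    AffineMap.lineMap_apply_one, sub_zero, div_one] at hslope
  rw [_root_.gradient, InnerProductSpace.toDual_symm_apply]
  exact hslope

/-- The inner product of a continuous and an integrable function on a compact interval is
integrable. -/
theorem IntegrableOn.continuousOn_inner {n : ℕ} {u v : ℝ → E n} {a b : ℝ}
    (hu : ContinuousOn u (Icc a b)) (hv : IntegrableOn v (Icc a b)) :
    IntegrableOn (fun t => ⟪u t, v t⟫) (Icc a b) := by
  simp only [PiLp.inner_apply]
  refine integrable_finsetSum _ fun i _ => ?_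
  have hui : ContinuousOn (fun t => u t i) (Icc a b) :=
    (EuclideanSpace.proj (𝕜 := ℝ) i).continuous.comp_continuousOn hu
  have hvi : IntegrableOn (fun t => v t i) (Icc a b) :=
    (EuclideanSpace.proj (𝕜 := ℝ) i).integrable_comp hv
  simp only [RCLike.inner_apply, conj_trivial]
  exact hvi.mul_continuousOn hui isCompact_Icc

theorem inner3_sum_smul_left {n m : ℕ} (a : Fin m → ℝ) (s : Fin m → E n × E n × E n)
    (b : E n × E n × E n) :
    inner3 (∑ k, a k • s k) b = ∑ k, a k * inner3 (s k) b := by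
  simp only [inner3, Prod.fst_sum, Prod.snd_sum, Prod.smul_fst, Prod.smul_snd, sum_inner,
    real_inner_smul_left, mul_add, Finset.sum_add_distrib]

/-- A nonnegative combination of subgradients of constraints, satisfying complementary slackness,
pairs nonpositively with directions towards feasible points. -/
theorem inner3_sum_smul_nonpos {n m : ℕ} {W : Fin m → E n × E n × E n → ℝ}
    {z y : E n × E n × E n} {a : Fin m → ℝ} {s : Fin m → E n × E n × E n}
    (ha : ∀ k, 0 ≤ a k) (hs : ∀ k, IsSubgrad3 (W k) z (s k)) (hslack : ∀ k, a k * W k z = 0)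
    (hy : ∀ k, W k y ≤ 0) : inner3 (∑ k, a k • s k) (y - z) ≤ 0 := by
  rw [inner3_sum_smul_left]
  refine Finset.sum_nonpos fun k _ => ?_
  have h1 := mul_le_mul_of_nonneg_left (hs k y) (ha k)
  have h2 := mul_nonpos_of_nonneg_of_nonpos (ha k) (hy k)
  have h3 := hslack k
  rw [mul_sub] at h1
  linarith

theorem stmt19 (n m : ℕ) (Q0 Q1 : Set (E n))
    (hQ0 : Convex ℝ Q0) (hQ1 : Convex ℝ Q1)
    (f : ℝ → E n → ℝ) (q : E n → ℝ)
    (W : Fin m → E n × E n × E n → ℝ)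
    (hfconv : ∀ t, ConvexOn ℝ univ (f t))
    (hfdiff : ∀ t, Differentiable ℝ (f t))
    (hfint : ∀ x x' x'' : ℝ → E n, FeasibleBV n m W Q0 Q1 x x' x'' →
      IntervalIntegrable (fun t => f t (x t)) volume 0 1)
    (hWconv : ∀ k, ConvexOn ℝ univ (W k))
    (hqconv : ConvexOn ℝ univ q)
    (xtil xtil' xtil'' : ℝ → E n)
    (hfeas : FeasibleBV n m W Q0 Q1 xtil xtil' xtil'')
    (xs xs' xs'' ψs ψs' : ℝ → E n)
    (hxs : ∀ t ∈ Icc (0 : ℝ) 1, HasDerivWithinAt xs (xs' t) (Icc 0 1) t)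
    (hxs' : ∀ t ∈ Icc (0 : ℝ) 1, HasDerivWithinAt xs' (xs'' t) (Icc 0 1) t)
    (hψs : ∀ t ∈ Icc (0 : ℝ) 1, HasDerivWithinAt ψs (ψs' t) (Icc 0 1) t)
    (hxsint : IntegrableOn xs'' (Icc (0 : ℝ) 1))
    (hψsint : IntegrableOn ψs' (Icc (0 : ℝ) 1))
    (α : Fin m → ℝ → ℝ)
    (hαmeas : ∀ k, Measurable (α k))
    (hαpos : ∀ k, ∀ t ∈ Icc (0 : ℝ) 1, 0 ≤ α k t)
    -- the adjoint inclusion and complementary slackness, a.e. on [0,1]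
    (hadj : ∀ᵐ t : ℝ ∂volume, t ∈ Icc (0 : ℝ) 1 →
      (∃ sk : Fin m → E n × E n × E n,
        (∀ k, IsSubgrad3 (W k) (xtil t, xtil' t, xtil'' t) (sk k)) ∧
        (xs'' t + ψs' t - gradient (f t) (xtil t), ψs t, -xs t) =
          ∑ k, α k t • sk k) ∧
      (∀ k, α k t * W k (xtil t, xtil' t, xtil'' t) = 0))
    -- dual cone (transversality) conditions at the endpoints
    (hQ0dual : ∀ w ∈ Q0, ⟪-ψs 0 - xs' 0, w - xtil 0⟫ ≥ 0)
    (hQ1dual : ∀ w ∈ Q1, ⟪ψs 1, w - xtil 1⟫ ≥ 0)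
    (htrans : IsSubgrad1 q (xtil 1) (-xs' 1))
    (hend0 : xs 0 = 0) (hend1 : xs 1 = 0) :
    ∀ x x' x'' : ℝ → E n, FeasibleBV n m W Q0 Q1 x x' x'' →
      J n f q x ≥ J n f q xtil := by
  intro x x' x'' hx
  have hfx := hfint x x' x'' hx
  have hfxtil := hfint xtil xtil' xtil'' hfeas
  obtain ⟨hd1, hd2, hx''int, hW, hx0, hx1⟩ := hx
  obtain ⟨hd1', hd2', hxtil''int, -, -, -⟩ := hfeas
  set d : ℝ → E n := fun t => x t - xtil t with hd_def
  set d' : ℝ → E n := fun t => x' t - xtil' t with hd'_def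
  set d'' : ℝ → E n := fun t => x'' t - xtil'' t with hd''_def
  have hd : ∀ t ∈ Icc (0 : ℝ) 1, HasDerivWithinAt d (d' t) (Icc 0 1) t :=
    fun t ht => (hd1 t ht).sub (hd1' t ht)
  have hd' : ∀ t ∈ Icc (0 : ℝ) 1, HasDerivWithinAt d' (d'' t) (Icc 0 1) t :=
    fun t ht => (hd2 t ht).sub (hd2' t ht)
  have hd''int : IntegrableOn d'' (Icc (0 : ℝ) 1) := hx''int.sub hxtil''int
  have hdc : ContinuousOn d (Icc 0 1) := fun t ht => (hd t ht).continuousWithinAt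
  have hd'c : ContinuousOn d' (Icc 0 1) := fun t ht => (hd' t ht).continuousWithinAt
  have hxsc : ContinuousOn xs (Icc 0 1) := fun t ht => (hxs t ht).continuousWithinAt
  have hψc : ContinuousOn ψs (Icc 0 1) := fun t ht => (hψs t ht).continuousWithinAt
  set G : ℝ → ℝ := fun t => ⟪d t, xs' t⟫ - ⟪xs t, d' t⟫ + ⟪d t, ψs t⟫ with hG_def
  set g : ℝ → ℝ := fun t =>
    ⟪d t, xs'' t⟫ - ⟪xs t, d'' t⟫ + ⟪d t, ψs' t⟫ + ⟪ψs t, d' t⟫ with hg_def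
  have hG : ∀ t ∈ Icc (0 : ℝ) 1, HasDerivWithinAt G (g t) (Icc 0 1) t := by
    intro t ht
    refine ((((hd t ht).inner ℝ (hxs' t ht)).sub ((hxs t ht).inner ℝ (hd' t ht))).add
      ((hd t ht).inner ℝ (hψs t ht))).congr_deriv ?_
    simp only [hg_def, real_inner_comm (d' t)]
    ring
  have hgint : IntervalIntegrable g volume 0 1 := by
    rw [intervalIntegrable_iff_integrableOn_Icc_of_le zero_le_one]
    exact (((IntegrableOn.continuousOn_inner hdc hxsint).sub
      (IntegrableOn.continuousOn_inner hxsc hd''int)).add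
      (IntegrableOn.continuousOn_inner hdc hψsint)).add
      (IntegrableOn.continuousOn_inner hψc hd'c.integrableOn_Icc)
  have hFTC : ∫ t in (0 : ℝ)..1, g t = G 1 - G 0 :=
    intervalIntegral.integral_eq_sub_of_hasDerivAt_of_le zero_le_one
      (fun t ht => (hG t ht).continuousWithinAt)
      (fun t ht => (hG t (Ioo_subset_Icc_self ht)).hasDerivAt (Icc_mem_nhds ht.1 ht.2)) hgint
  have hle : ∀ᵐ t ∂volume.restrict (Icc (0 : ℝ) 1), g t ≤ f t (x t) - f t (xtil t) := by
    rw [ae_restrict_iff' measurableSet_Icc]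
    filter_upwards [hW, hadj] with t hWt hadjt ht
    obtain ⟨⟨sk, hsk, heq⟩, hslack⟩ := hadjt ht
    have hpair := inner3_sum_smul_nonpos (fun k => hαpos k t ht) hsk hslack (hWt ht)
    rw [← heq] at hpair
    have hgrad := IsSubgrad1.gradient (hfconv t) (hfdiff t) (xtil t) (x t)
    simp only [inner3, Prod.fst_sub, Prod.snd_sub, inner_sub_left, inner_add_left,
      inner_neg_left] at hpair
    simp only [hg_def, hd_def, hd'_def, hd''_def, real_inner_comm _ (x t - xtil t)]
    linarith
  have hmono := intervalIntegral.integral_mono_ae_restrict zero_le_one hgint (hfx.sub hfxtil) hle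
  rw [intervalIntegral.integral_sub hfx hfxtil, hFTC] at hmono
  have hq := htrans (x 1)
  have h0 := hQ0dual _ hx0
  have h1 := hQ1dual _ hx1
  simp only [hG_def, hd_def, hend0, hend1, inner_zero_left, real_inner_comm _ (x _ - xtil _)]
    at hmono
  simp only [inner_sub_left, inner_neg_left] at hq h0
  simp only [J]
  linarith
end
end
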